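/- arXiv:1205.0907 — 2 statements merged into one kernel-verified Lean document; each statement's English description precedes it below -/
import Mathlib

section
/- Let (u_j(t))_{j∈ℤ} solve the semi-discrete scheme u_j'(t) + D_−F(u_j,u_{j+1}) = D_−D_+A(u_j), where F(u,v) = F₁(u) + F₂(v) is a monotone split flux. Then for every constant c ∈ ℝ, every ε > 0, every j ∈ ℤ and every t: d/dt ψ_ε(u_j,c) + D_−Q^c(u_j,u_{j+1}) − D_−D_+ |A(u_j) − A(c)|_ε ≤ − (1/Δx²) ∫_{u_{j+1}}^{u_j} ψ_ε''(z,c)(A(z) − A(u_{j+1})) dz − (1/Δx²) ∫_{u_{j−1}}^{u_j} ψ_ε''(z,c)(A(z) − A(u_{j−1})) dz, where Q^c(u,v) = ∫_c^u ψ_ε'(z,c) F₁'(z) dz + ∫_c^v ψ_ε'(z,c) F₂'(z) dz. -/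
open MeasureTheory

/-- The Lipschitz approximation of the sign function. -/
noncomputable def signe (ε σ : ℝ) : ℝ :=
  if |σ| < ε then Real.sin (Real.pi * σ / (2 * ε)) else Real.sign σ

/-- `|u|_ε = ∫₀ᵘ sign_ε(z) dz`. -/
noncomputable def abse (ε u : ℝ) : ℝ := ∫ z in (0:ℝ)..u, signe ε z

/-- The entropy `ψ_ε(u,c) = ∫_c^u sign_ε(A(z) − A(c)) dz`. -/
noncomputable def psie (A : ℝ → ℝ) (ε u c : ℝ) : ℝ :=
  ∫ z in c..u, signe ε (A z - A c)

/-- `ψ_ε''(z,c) = sign_ε'(A(z) − A(c)) A'(z)`. -/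
noncomputable def psie'' (A : ℝ → ℝ) (ε z c : ℝ) : ℝ :=
  deriv (signe ε) (A z - A c) * deriv A z

/-- The numerical entropy flux
`Q^c(a,b) = ∫_c^a ψ_ε'(z,c) F₁'(z) dz + ∫_c^b ψ_ε'(z,c) F₂'(z) dz`. -/
noncomputable def QQ (A F₁ F₂ : ℝ → ℝ) (ε c a b : ℝ) : ℝ :=
  (∫ z in c..a, signe ε (A z - A c) * deriv F₁ z)
    + (∫ z in c..b, signe ε (A z - A c) * deriv F₂ z)

theorem signe_neg (ε σ : ℝ) : signe ε (-σ) = -signe ε σ := by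
  have h : Real.pi * -σ / (2 * ε) = -(Real.pi * σ / (2 * ε)) := by ring
  unfold signe
  rw [abs_neg, h, Real.sin_neg, Real.sign_neg]
  split_ifs <;> rfl

theorem signe_of_le {ε σ : ℝ} (hε : 0 < ε) (h : ε ≤ σ) : signe ε σ = 1 := by
  have h0 : 0 < σ := hε.trans_le h
  rw [signe, if_neg (by rw [abs_of_pos h0]; exact h.not_gt), Real.sign_of_pos h0]

theorem signe_of_abs_le {ε σ : ℝ} (hε : 0 < ε) (h : |σ| ≤ ε) :
    signe ε σ = Real.sin (Real.pi / (2 * ε) * σ) := by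
  have key : Real.pi / (2 * ε) * ε = Real.pi / 2 := by field_simp
  rcases h.lt_or_eq with h | h
  · rw [signe, if_pos h]
    congr 1
    ring
  · rcases (abs_eq hε.le).1 h with rfl | rfl
    · rw [signe_of_le hε le_rfl, key, Real.sin_pi_div_two]
    · rw [signe_neg, signe_of_le hε le_rfl, mul_neg, key, Real.sin_neg, Real.sin_pi_div_two]

/-- The derivative of the regularized sign, written with the argument clamped to `[-ε, ε]`. -/
noncomputable def signeDeriv (ε σ : ℝ) : ℝ :=
  Real.pi / (2 * ε) * Real.cos (Real.pi / (2 * ε) * max (-ε) (min ε σ))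

theorem signeDeriv_of_abs_le {ε σ : ℝ} (h : |σ| ≤ ε) :
    signeDeriv ε σ = Real.pi / (2 * ε) * Real.cos (Real.pi / (2 * ε) * σ) := by
  rw [abs_le] at h
  rw [signeDeriv, min_eq_right h.2, max_eq_right h.1]

theorem signeDeriv_of_le {ε σ : ℝ} (hε : 0 < ε) (h : ε ≤ σ) : signeDeriv ε σ = 0 := by
  have key : Real.pi / (2 * ε) * ε = Real.pi / 2 := by field_simp
  rw [signeDeriv, min_eq_left h, max_eq_right (by linarith), key, Real.cos_pi_div_two, mul_zero]

theorem signeDeriv_neg {ε : ℝ} (hε : 0 < ε) (σ : ℝ) : signeDeriv ε (-σ) = signeDeriv ε σ := by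
  have h : max (-ε) (min ε (-σ)) = -max (-ε) (min ε σ) := by
    simp only [max_def, min_def]
    split_ifs <;> linarith
  rw [signeDeriv, h, mul_neg, Real.cos_neg, signeDeriv]

theorem continuous_signeDeriv (ε : ℝ) : Continuous (signeDeriv ε) := by
  unfold signeDeriv
  fun_prop

theorem signeDeriv_nonneg {ε : ℝ} (hε : 0 < ε) (σ : ℝ) : 0 ≤ signeDeriv ε σ := by
  have hk : 0 < Real.pi / (2 * ε) := by positivity
  have key : Real.pi / (2 * ε) * ε = Real.pi / 2 := by field_simp
  have h1 : -ε ≤ max (-ε) (min ε σ) := le_max_left _ _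
  have h2 : max (-ε) (min ε σ) ≤ ε := max_le (by linarith) (min_le_left _ _)
  refine mul_nonneg hk.le (Real.cos_nonneg_of_neg_pi_div_two_le_of_le ?_ ?_)
  · have := mul_le_mul_of_nonneg_left h1 hk.le
    linarith
  · have := mul_le_mul_of_nonneg_left h2 hk.le
    linarith

theorem hasDerivAt_signe {ε : ℝ} (hε : 0 < ε) (σ : ℝ) :
    HasDerivAt (signe ε) (signeDeriv ε σ) σ := by
  have hsin (x : ℝ) : HasDerivAt (fun y => Real.sin (Real.pi / (2 * ε) * y))
      (Real.pi / (2 * ε) * Real.cos (Real.pi / (2 * ε) * x)) x := by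
    have := ((hasDerivAt_id x).const_mul (Real.pi / (2 * ε))).sin
    simpa [mul_comm] using this
  have main (σ : ℝ) (h0 : 0 ≤ σ) : HasDerivAt (signe ε) (signeDeriv ε σ) σ := by
    rcases lt_trichotomy σ ε with h | rfl | h
    · have ha : |σ| < ε := by rwa [abs_of_nonneg h0]
      rw [signeDeriv_of_abs_le ha.le]
      refine (hsin σ).congr_of_eventuallyEq ?_
      filter_upwards [continuous_abs.continuousAt.eventually_lt_const ha] with y hy
      exact signe_of_abs_le hε hy.le
    · have hl : HasDerivWithinAt (signe σ) (signeDeriv σ σ) (Set.Icc (-σ) σ) σ := by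
        rw [signeDeriv_of_abs_le (abs_of_nonneg h0).le]
        exact (hsin σ).hasDerivWithinAt.congr (fun y hy => signe_of_abs_le hε (abs_le.2 hy))
          (signe_of_abs_le hε (abs_of_nonneg h0).le)
      have hr : HasDerivWithinAt (signe σ) (signeDeriv σ σ) (Set.Ici σ) σ := by
        rw [signeDeriv_of_le hε le_rfl]
        exact (hasDerivWithinAt_const σ _ (1 : ℝ)).congr (fun y hy => signe_of_le hε hy)
          (signe_of_le hε le_rfl)
      have hu := hl.union hr
      rw [Set.Icc_union_Ici_eq_Ici (by linarith)] at hu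
      exact hu.hasDerivAt (Ici_mem_nhds (by linarith))
    · rw [signeDeriv_of_le hε h.le]
      refine (hasDerivAt_const σ (1 : ℝ)).congr_of_eventuallyEq ?_
      filter_upwards [Ioi_mem_nhds h] with y hy
      exact signe_of_le hε (le_of_lt hy)
  rcases le_total 0 σ with h | h
  · exact main σ h
  · have hn := ((main (-σ) (by linarith)).comp σ (hasDerivAt_neg σ)).neg
    rw [signeDeriv_neg hε] at hn
    refine (hn.congr_deriv (by ring)).congr_of_eventuallyEq (.of_forall fun y => ?_)
    simp [signe_neg]

theorem continuous_signe {ε : ℝ} (hε : 0 < ε) : Continuous (signe ε) :=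
  continuous_iff_continuousAt.2 fun σ => (hasDerivAt_signe hε σ).continuousAt

theorem monotone_signe {ε : ℝ} (hε : 0 < ε) : Monotone (signe ε) :=
  monotone_of_deriv_nonneg (fun σ => (hasDerivAt_signe hε σ).differentiableAt) fun σ => by
    rw [(hasDerivAt_signe hε σ).deriv]
    exact signeDeriv_nonneg hε σ

theorem hasDerivAt_abse {ε : ℝ} (hε : 0 < ε) (x : ℝ) : HasDerivAt (abse ε) (signe ε x) x :=
  (continuous_signe hε).integral_hasStrictDerivAt 0 x |>.hasDerivAt

theorem hasDerivAt_psie {A : ℝ → ℝ} (hA : Continuous A) {ε : ℝ} (hε : 0 < ε) (c x : ℝ) :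
    HasDerivAt (fun y => psie A ε y c) (signe ε (A x - A c)) x :=
  ((continuous_signe hε).comp (hA.sub continuous_const)).integral_hasStrictDerivAt c x
    |>.hasDerivAt

/-- Integration by parts for the regularized entropy. -/
theorem integral_psie''_mul {A : ℝ → ℝ} (hA : ContDiff ℝ 1 A) {ε : ℝ} (hε : 0 < ε)
    (c a b : ℝ) :
    ∫ z in b..a, psie'' A ε z c * (A z - A b) =
      signe ε (A a - A c) * (A a - A b) - abse ε (A a - A c) + abse ε (A b - A c) := by
  have hd (x : ℝ) : HasDerivAt A (deriv A x) x :=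
    (hA.differentiable one_ne_zero x).hasDerivAt
  have hcA : Continuous A := hA.continuous
  have hcA' : Continuous (deriv A) := hA.continuous_deriv le_rfl
  have hder (x : ℝ) : HasDerivAt
      (fun z => signe ε (A z - A c) * (A z - A b) - abse ε (A z - A c))
      (psie'' A ε x c * (A x - A b)) x := by
    have hs := (hasDerivAt_signe hε (A x - A c)).comp x ((hd x).sub_const (A c))
    have ha := (hasDerivAt_abse hε (A x - A c)).comp x ((hd x).sub_const (A c))
    have h := (hs.mul ((hd x).sub_const (A b))).sub ha
    refine h.congr_deriv ?_
    rw [psie'', (hasDerivAt_signe hε _).deriv]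
    simp only [Function.comp_apply]
    ring
  have hcont : Continuous fun z => psie'' A ε z c * (A z - A b) := by
    have hs : deriv (signe ε) = signeDeriv ε := funext fun σ => (hasDerivAt_signe hε σ).deriv
    unfold psie''
    rw [hs]
    have := continuous_signeDeriv ε
    fun_prop
  rw [intervalIntegral.integral_eq_sub_of_hasDerivAt (fun x _ => hder x)
    (hcont.intervalIntegrable _ _)]
  ring

/-- A monotone weight is bounded by its value at the upper endpoint, for either orientation of the
interval. -/
theorem integral_monotone_mul_deriv_le {s F : ℝ → ℝ} (hs : Monotone s) (hsc : Continuous s)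
    (hF : ContDiff ℝ 1 F) (hF' : ∀ z, 0 ≤ deriv F z) (a b : ℝ) :
    ∫ z in a..b, s z * deriv F z ≤ s b * (F b - F a) := by
  have hc : Continuous (deriv F) := hF.continuous_deriv le_rfl
  have hi : s b * (F b - F a) = ∫ z in a..b, s b * deriv F z := by
    rw [intervalIntegral.integral_const_mul, intervalIntegral.integral_deriv_eq_sub
      (fun x _ => hF.differentiable one_ne_zero x) (hc.intervalIntegrable _ _)]
  have h1 (p q : ℝ) : IntervalIntegrable (fun z => s z * deriv F z) volume p q :=
    (hsc.mul hc).intervalIntegrable _ _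
  have h2 (p q : ℝ) : IntervalIntegrable (fun z => s b * deriv F z) volume p q :=
    (continuous_const.mul hc).intervalIntegrable _ _
  rw [hi]
  rcases le_total a b with h | h
  · exact intervalIntegral.integral_mono_on h (h1 a b) (h2 a b) fun z hz =>
      mul_le_mul_of_nonneg_right (hs hz.2) (hF' z)
  · rw [intervalIntegral.integral_symm b a, intervalIntegral.integral_symm b a, neg_le_neg_iff]
    exact intervalIntegral.integral_mono_on h (h2 b a) (h1 b a) fun z hz =>
      mul_le_mul_of_nonneg_right (hs hz.1) (hF' z)

/-- the discrete entropy inequality for the semi-discrete scheme. -/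
theorem stmt_8 (Δx : ℝ) (hΔx : 0 < Δx)
    (f A F₁ F₂ : ℝ → ℝ)
    (hf : ContDiff ℝ 1 f) (hA : ContDiff ℝ 1 A) (hA' : ∀ z, 0 ≤ deriv A z)
    (hF₁ : ContDiff ℝ 1 F₁) (hF₂ : ContDiff ℝ 1 F₂)
    (hF₁' : ∀ z, 0 ≤ deriv F₁ z) (hF₂' : ∀ z, deriv F₂ z ≤ 0)
    (hsum : ∀ z, deriv F₁ z + deriv F₂ z = deriv f z)
    (u : ℝ → ℤ → ℝ)
    (hODE : ∀ (t : ℝ) (j : ℤ), HasDerivAt (fun t' => u t' j)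
      (-(((F₁ (u t j) + F₂ (u t (j+1))) - (F₁ (u t (j-1)) + F₂ (u t j))) / Δx)
        + (A (u t (j+1)) - 2 * A (u t j) + A (u t (j-1))) / Δx ^ 2) t)
    (c ε : ℝ) (hε : 0 < ε) (t : ℝ) (j : ℤ) :
    deriv (fun t' => psie A ε (u t' j) c) t
      + (QQ A F₁ F₂ ε c (u t j) (u t (j+1)) - QQ A F₁ F₂ ε c (u t (j-1)) (u t j)) / Δx
      - (abse ε (A (u t (j+1)) - A c) - 2 * abse ε (A (u t j) - A c)
          + abse ε (A (u t (j-1)) - A c)) / Δx ^ 2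
    ≤ -(1 / Δx ^ 2) * (∫ z in (u t (j+1))..(u t j), psie'' A ε z c * (A z - A (u t (j+1))))
      - (1 / Δx ^ 2) * (∫ z in (u t (j-1))..(u t j), psie'' A ε z c * (A z - A (u t (j-1)))) := by
  have hcA : Continuous A := hA.continuous
  have hmA : Monotone A := monotone_of_deriv_nonneg (hA.differentiable one_ne_zero) hA'
  have hsc : Continuous fun z => signe ε (A z - A c) :=
    (continuous_signe hε).comp (hcA.sub continuous_const)
  have hsm : Monotone fun z => signe ε (A z - A c) := fun x y h =>
    monotone_signe hε (sub_le_sub_right (hmA h) _)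
  have hdt := ((hasDerivAt_psie hcA hε c (u t j)).comp t (hODE t j)).deriv
  simp only [Function.comp_def] at hdt
  rw [hdt, integral_psie''_mul hA hε, integral_psie''_mul hA hε]
  have hint {F : ℝ → ℝ} (hF : ContDiff ℝ 1 F) (p q : ℝ) :
      IntervalIntegrable (fun z => signe ε (A z - A c) * deriv F z) volume p q :=
    (hsc.mul (hF.continuous_deriv le_rfl)).intervalIntegrable _ _
  have h1 := integral_monotone_mul_deriv_le hsm hsc hF₁ hF₁' (u t (j-1)) (u t j)
  have h2 := integral_monotone_mul_deriv_le hsm hsc hF₂.neg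
    (fun z => by rw [deriv.fun_neg]; exact neg_nonneg.2 (hF₂' z)) (u t (j+1)) (u t j)
  simp only [deriv.fun_neg, mul_neg, intervalIntegral.integral_neg] at h2
  rw [← intervalIntegral.integral_interval_sub_left (hint hF₁ c _) (hint hF₁ c _)] at h1
  rw [← intervalIntegral.integral_interval_sub_left (hint hF₂ c _) (hint hF₂ c _)] at h2
  have h3 := div_le_div_of_nonneg_right (add_le_add h1 h2) hΔx.le
  unfold QQ
  rw [← sub_nonneg] at h3 ⊢
  refine h3.trans_eq ?_
  ring
end

section
/- With u_Δx the piecewise constant semi-discrete approximation, u the classical solution, and φ the test function described in the context, one has |∬_{Π_T²} ( ∫_{u_Δx(x,t)}^{u_Δx(x+Δx,t)} sign(z − u(y,s)) F₂'(z) dz ) D_+φ dX| ≤ C (Δx/r)(1 + Δx/r), where C depends only on T, ρ, the Lipschitz constant of F₂, and |u⁰|_{BV(ℝ)}, but not on Δx, r, r₀, α. -/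
open MeasureTheory Set Filter

/-- The scaled mollifier `ω_r(x) = ρ(x/r)/r`. -/
noncomputable def moll (ρ : ℝ → ℝ) (r x : ℝ) : ℝ := ρ (x / r) / r

/-- `H_α(t) = ∫_{-∞}^t ρ_α(ξ) dξ`. -/
noncomputable def Hmoll (ρ : ℝ → ℝ) (α t : ℝ) : ℝ := ∫ ξ in Set.Iic t, moll ρ α ξ

/-- The test function
`φ(x,t,y,s) = (H_α(t−ν) − H_α(t−τ)) ω_r(x−y) ρ_{r₀}(t−s)`. -/
noncomputable def testphi (ρ : ℝ → ℝ) (r r₀ α ν τ x t y s : ℝ) : ℝ :=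
  (Hmoll ρ α (t - ν) - Hmoll ρ α (t - τ)) * moll ρ r (x - y) * moll ρ r₀ (t - s)

/-- A function of the cell index integrates over the line to the mesh width times its sum. -/
theorem lintegral_comp_cell_le (g : ℤ → ENNReal) {h : ℝ} (hh : 0 < h) :
    ∫⁻ x : ℝ, g ⌈x / h - 1 / 2⌉ ≤ ENNReal.ofReal h * ∑' j : ℤ, g j := by
  calc ∫⁻ x : ℝ, g ⌈x / h - 1 / 2⌉
      ≤ ∫⁻ x : ℝ, ∑' j : ℤ,
          (Set.Ioc (((j : ℝ) - 1 / 2) * h) (((j : ℝ) + 1 / 2) * h)).indicator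
            (fun _ => g j) x := by
        refine lintegral_mono fun x => ?_
        refine le_trans (le_of_eq ?_) (ENNReal.le_tsum ⌈x / h - 1 / 2⌉)
        rw [Set.indicator_of_mem]
        have h1 := Int.le_ceil (x / h - 1 / 2)
        have h2 := Int.ceil_lt_add_one (x / h - 1 / 2)
        constructor
        · rw [← lt_div_iff₀ hh]; linarith
        · rw [← div_le_iff₀ hh]; linarith
    _ = ∑' j : ℤ, ENNReal.ofReal h * g j := by
        rw [lintegral_tsum fun j => (measurable_const.indicator measurableSet_Ioc).aemeasurable]
        refine tsum_congr fun j => ?_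
        rw [lintegral_indicator_const measurableSet_Ioc, Real.volume_Ioc, mul_comm]
        congr 2
        ring
    _ = ENNReal.ofReal h * ∑' j : ℤ, g j := ENNReal.tsum_mul_left

theorem moll_nonneg {ρ : ℝ → ℝ} (hρ : ∀ x, 0 ≤ ρ x) {r : ℝ} (hr : 0 < r) (x : ℝ) :
    0 ≤ moll ρ r x :=
  div_nonneg (hρ _) hr.le

theorem integrable_moll {ρ : ℝ → ℝ} (hρ : Integrable ρ) {r : ℝ} (hr : 0 < r) :
    Integrable (moll ρ r) :=
  (hρ.comp_div hr.ne').div_const r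

theorem integral_moll (ρ : ℝ → ℝ) {r : ℝ} (hr : 0 < r) :
    ∫ x, moll ρ r x = ∫ x, ρ x := by
  simp only [moll]
  rw [integral_div, Measure.integral_comp_div ρ r, abs_of_pos hr, smul_eq_mul]
  field_simp

theorem Hmoll_mem_Icc {ρ : ℝ → ℝ} (hρpos : ∀ x, 0 ≤ ρ x) (hρi : Integrable ρ)
    (hρint : ∫ x, ρ x = 1) {α : ℝ} (hα : 0 < α) (t : ℝ) :
    Hmoll ρ α t ∈ Set.Icc (0 : ℝ) 1 := by
  refine ⟨integral_nonneg fun x => moll_nonneg hρpos hα x, ?_⟩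
  rw [← hρint, ← integral_moll ρ hα]
  exact setIntegral_le_integral (integrable_moll hρi hα)
    (Filter.Eventually.of_forall fun x => moll_nonneg hρpos hα x)

theorem setLIntegral_moll_le_one {ρ : ℝ → ℝ} (hρpos : ∀ x, 0 ≤ ρ x) (hρi : Integrable ρ)
    (hρint : ∫ x, ρ x = 1) {r : ℝ} (hr : 0 < r) (t : ℝ) (S : Set ℝ) :
    ∫⁻ s in S, ENNReal.ofReal (moll ρ r (t - s)) ≤ 1 := by
  refine (setLIntegral_le_lintegral S _).trans ?_
  rw [← ofReal_integral_eq_lintegral_ofReal ((integrable_moll hρi hr).comp_sub_left t)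
    (Filter.Eventually.of_forall fun s => moll_nonneg hρpos hr (t - s)),
    integral_sub_left_eq_self, integral_moll ρ hr, hρint, ENNReal.ofReal_one]

/-- The difference quotient of a mollifier is bounded by `K / r²` and supported in
`[x - r, x + h + r]`. -/
theorem abs_moll_sub_moll_div_le {ρ : ℝ → ℝ} {K : NNReal} (hK : LipschitzWith K ρ)
    (hρsupp : tsupport ρ ⊆ Set.Icc (-1) 1) {r h : ℝ} (hr : 0 < r) (hh : 0 < h) (x y : ℝ) :
    |(moll ρ r (x + h - y) - moll ρ r (x - y)) / h| ≤
      (Set.Icc (x - r) (x + h + r)).indicator (fun _ => (K : ℝ) / r ^ 2) y := by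
  by_cases hy : y ∈ Set.Icc (x - r) (x + h + r)
  · rw [Set.indicator_of_mem hy, abs_div, abs_of_pos hh, div_le_iff₀ hh]
    have h1 := hK.dist_le_mul ((x + h - y) / r) ((x - y) / r)
    rw [Real.dist_eq, Real.dist_eq, ← sub_div,
      show x + h - y - (x - y) = h by ring, abs_of_pos (div_pos hh hr)] at h1
    rw [moll, moll, ← sub_div, abs_div, abs_of_pos hr, div_le_iff₀ hr]
    refine h1.trans (le_of_eq ?_)
    field_simp
  · have hz : ∀ z, z ∉ Set.Icc (-1 : ℝ) 1 → ρ z = 0 := fun z hz =>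
      image_eq_zero_of_notMem_tsupport fun h' => hz (hρsupp h')
    have hz' : ∀ z, z ∉ Set.Icc (-r) r → moll ρ r z = 0 := by
      intro z hzr
      rw [moll, hz, zero_div]
      rintro ⟨h1, h2⟩
      rw [le_div_iff₀ hr] at h1
      rw [div_le_iff₀ hr] at h2
      exact hzr ⟨by linarith, by linarith⟩
    rw [Set.indicator_of_notMem hy, hz', hz']
    · simp
    · rintro ⟨h1, h2⟩
      exact hy ⟨by linarith, by linarith⟩
    · rintro ⟨h1, h2⟩
      exact hy ⟨by linarith, by linarith⟩

theorem abs_integral_sign_mul_deriv_le {F : ℝ → ℝ} {L : NNReal} (hF : LipschitzWith L F)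
    (a b v : ℝ) : |∫ z in a..b, Real.sign (z - v) * deriv F z| ≤ L * |b - a| := by
  rw [← Real.norm_eq_abs]
  refine intervalIntegral.norm_integral_le_of_norm_le_const fun z _ => ?_
  rw [norm_mul]
  have h1 : ‖Real.sign (z - v)‖ ≤ 1 := by
    rcases Real.sign_apply_eq (z - v) with h | h | h <;> rw [h] <;> simp
  calc _ ≤ 1 * (L : ℝ) := by
        gcongr
        exact norm_deriv_le_of_lipschitz hF
    _ = L := one_mul _

/-- Estimate `gamma3Est`:
`|∬ (∫_{u_Δx(x,t)}^{u_Δx(x+Δx,t)} sign(z − u) F₂'(z) dz) D₊φ dX|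
  ≤ C (Δx/r)(1 + Δx/r)`,
with `C` depending only on `T`, `ρ`, the Lipschitz constant of `F₂` and
`|u⁰|_{BV}`, but not on `Δx, r, r₀, α`. -/
theorem stmt_16
    (T : ℝ) (hT : 0 < T)
    (ρ : ℝ → ℝ) (hρs : ContDiff ℝ (⊤ : ℕ∞) ρ) (hρsupp : tsupport ρ ⊆ Set.Icc (-1) 1)
    (hρeven : ∀ x, ρ (-x) = ρ x) (hρpos : ∀ x, 0 ≤ ρ x) (hρint : ∫ x, ρ x = 1)
    (L₂ : NNReal) (V : ℝ) :
    ∃ C : ℝ, 0 < C ∧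
      ∀ (f A F₁ F₂ : ℝ → ℝ) (u0 : ℝ → ℝ) (uE : ℝ → ℝ → ℝ) (uG : ℝ → ℤ → ℝ)
        (Δx r r₀ α ν τ : ℝ),
        ContDiff ℝ 1 f → (∃ L : NNReal, LipschitzWith L f) →
        ContDiff ℝ 1 A → (∀ z, 0 < deriv A z) →
        ContDiff ℝ 1 F₁ → ContDiff ℝ 1 F₂ → LipschitzWith L₂ F₂ →
        (∀ z, 0 ≤ deriv F₁ z) → (∀ z, deriv F₂ z ≤ 0) →
        (∀ z, deriv F₁ z + deriv F₂ z = deriv f z) →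
        (∃ L : NNReal, LipschitzWith L F₁ ∧ LipschitzWith L F₂) →
        Integrable u0 → (∃ M, ∀ x, |u0 x| ≤ M) →
        eVariationOn u0 Set.univ ≤ ENNReal.ofReal V →
        0 < Δx → 0 < r →
        0 < ν → ν < τ → τ < T →
        0 < r₀ → r₀ < min ν (T - τ) →
        0 < α → α < min (ν - r₀) (T - τ - r₀) →
        -- the semi-discrete scheme
        (∀ t ∈ Set.Icc (0:ℝ) T, ∀ j : ℤ, HasDerivAt (fun t' => uG t' j)
          (-(((F₁ (uG t j) + F₂ (uG t (j+1))) - (F₁ (uG t (j-1)) + F₂ (uG t j))) / Δx)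
            + (A (uG t (j+1)) - 2 * A (uG t j) + A (uG t (j-1))) / Δx ^ 2) t) →
        (∀ j : ℤ, uG 0 j
          = (1 / Δx) * ∫ x in Set.Ioc (((j:ℝ) - 1/2) * Δx) (((j:ℝ) + 1/2) * Δx), u0 x) →
        (∀ t ∈ Set.Icc (0:ℝ) T,
          (∑' j : ℤ, (‖uG t (j+1) - uG t j‖₊ : ENNReal)) ≤ ENNReal.ofReal V) →
        -- the classical solution on Π_T
        ContDiffOn ℝ 2 (fun p : ℝ × ℝ => uE p.1 p.2) (Set.univ ×ˢ Set.Ioo 0 T) →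
        (∀ y, uE y 0 = u0 y) →
        (∀ y : ℝ, ∀ s ∈ Set.Ioo (0:ℝ) T,
          deriv (fun s' => uE y s') s + deriv (fun y' => f (uE y' s)) y
            = deriv (fun y' => deriv (fun y'' => A (uE y'' s)) y') y) →
        (∀ s ∈ Set.Icc (0:ℝ) T,
          eVariationOn (fun y => uE y s) Set.univ ≤ ENNReal.ofReal V) →
        |∫ t in Set.Ioo (0:ℝ) T, ∫ x : ℝ, ∫ s in Set.Ioo (0:ℝ) T, ∫ y : ℝ,
            (∫ z in (uG t ⌈x / Δx - 1/2⌉)..(uG t (⌈x / Δx - 1/2⌉ + 1)),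
                Real.sign (z - uE y s) * deriv F₂ z)
              * ((testphi ρ r r₀ α ν τ (x + Δx) t y s - testphi ρ r r₀ α ν τ x t y s) / Δx)|
          ≤ C * (Δx / r) * (1 + Δx / r) := by
  have hcs : HasCompactSupport ρ := isCompact_Icc.of_isClosed_subset (isClosed_tsupport ρ) hρsupp
  have hρi : Integrable ρ := hρs.continuous.integrable_of_hasCompactSupport hcs
  obtain ⟨K, hK⟩ := (hρs.of_le (by simp) : ContDiff ℝ 1 ρ).lipschitzWith_of_hasCompactSupport
    hcs one_ne_zero
  refine ⟨T * L₂ * |V| * K * 2 + 1, by positivity, ?_⟩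
  intro f A F₁ F₂ u0 uE uG Δx r r₀ α ν τ _ _ _ _ _ _ hF₂ _ _ _ _ _ _ _ hΔ hr _ _ _ hr₀ _ hα _
    _ _ hBV _ _ _ _
  have hψ : ∀ t, |Hmoll ρ α (t - ν) - Hmoll ρ α (t - τ)| ≤ 1 := fun t => by
    have h1 := Hmoll_mem_Icc hρpos hρi hρint hα (t - ν)
    have h2 := Hmoll_mem_Icc hρpos hρi hρint hα (t - τ)
    rw [abs_le]
    constructor <;> linarith [h1.1, h1.2, h2.1, h2.2]
  set B : ENNReal := ENNReal.ofReal ((K : ℝ) / r ^ 2) * ENNReal.ofReal (2 * r + Δx) with hB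
  have hpt : ∀ t x s y : ℝ,
      ‖(∫ z in (uG t ⌈x / Δx - 1/2⌉)..(uG t (⌈x / Δx - 1/2⌉ + 1)),
          Real.sign (z - uE y s) * deriv F₂ z)
        * ((testphi ρ r r₀ α ν τ (x + Δx) t y s - testphi ρ r r₀ α ν τ x t y s) / Δx)‖ₑ
      ≤ (L₂ * ‖uG t (⌈x / Δx - 1/2⌉ + 1) - uG t ⌈x / Δx - 1/2⌉‖ₑ
          * ENNReal.ofReal (moll ρ r₀ (t - s)))
        * (Set.Icc (x - r) (x + Δx + r)).indicator
          (fun _ => ENNReal.ofReal ((K : ℝ) / r ^ 2)) y := by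
    intro t x s y
    have hind : (Set.Icc (x - r) (x + Δx + r)).indicator
          (fun _ => ENNReal.ofReal ((K : ℝ) / r ^ 2)) y = ENNReal.ofReal
        ((Set.Icc (x - r) (x + Δx + r)).indicator (fun _ => (K : ℝ) / r ^ 2) y) := by
      by_cases hy : y ∈ Set.Icc (x - r) (x + Δx + r)
      · simp only [Set.indicator_of_mem hy]
      · simp only [Set.indicator_of_notMem hy, ENNReal.ofReal_zero]
    have hm := moll_nonneg hρpos hr₀ (t - s)
    rw [hind, ← ofReal_norm, ← ofReal_norm, ← ENNReal.ofReal_coe_nnreal (p := L₂),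
      ← ENNReal.ofReal_mul (by positivity), ← ENNReal.ofReal_mul (by positivity),
      ← ENNReal.ofReal_mul (by positivity)]
    apply ENNReal.ofReal_le_ofReal
    rw [show (testphi ρ r r₀ α ν τ (x + Δx) t y s - testphi ρ r r₀ α ν τ x t y s) / Δx
        = (Hmoll ρ α (t - ν) - Hmoll ρ α (t - τ)) * moll ρ r₀ (t - s)
          * ((moll ρ r (x + Δx - y) - moll ρ r (x - y)) / Δx) by simp only [testphi]; ring,
      ← mul_assoc, norm_mul, norm_mul, norm_mul]
    simp only [Real.norm_eq_abs]
    rw [abs_of_nonneg hm]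
    gcongr
    · exact abs_integral_sign_mul_deriv_le hF₂ _ _ _
    · exact mul_le_of_le_one_left hm (hψ t)
    · exact abs_moll_sub_moll_div_le hK hρsupp hr hΔ x y
  have hy : ∀ t x s : ℝ, ‖∫ y : ℝ, (∫ z in (uG t ⌈x / Δx - 1/2⌉)..(uG t (⌈x / Δx - 1/2⌉ + 1)),
          Real.sign (z - uE y s) * deriv F₂ z)
        * ((testphi ρ r r₀ α ν τ (x + Δx) t y s - testphi ρ r r₀ α ν τ x t y s) / Δx)‖ₑ
      ≤ (L₂ * ‖uG t (⌈x / Δx - 1/2⌉ + 1) - uG t ⌈x / Δx - 1/2⌉‖ₑ * B)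
          * ENNReal.ofReal (moll ρ r₀ (t - s)) := by
    intro t x s
    refine (enorm_integral_le_lintegral_enorm _).trans ((lintegral_mono (hpt t x s)).trans ?_)
    rw [lintegral_const_mul _ (measurable_const.indicator measurableSet_Icc),
      lintegral_indicator_const measurableSet_Icc, Real.volume_Icc,
      show x + Δx + r - (x - r) = 2 * r + Δx by ring, ← hB, mul_right_comm]
  have hmeas : ∀ t : ℝ, Measurable fun s => ENNReal.ofReal (moll ρ r₀ (t - s)) := by
    intro t
    have := hρs.continuous.measurable
    unfold moll
    fun_prop
  have hs : ∀ t x : ℝ, ‖∫ s in Set.Ioo (0:ℝ) T, ∫ y : ℝ,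
        (∫ z in (uG t ⌈x / Δx - 1/2⌉)..(uG t (⌈x / Δx - 1/2⌉ + 1)),
          Real.sign (z - uE y s) * deriv F₂ z)
        * ((testphi ρ r r₀ α ν τ (x + Δx) t y s - testphi ρ r r₀ α ν τ x t y s) / Δx)‖ₑ
      ≤ L₂ * ‖uG t (⌈x / Δx - 1/2⌉ + 1) - uG t ⌈x / Δx - 1/2⌉‖ₑ * B := by
    intro t x
    refine (enorm_integral_le_lintegral_enorm _).trans ((lintegral_mono (hy t x)).trans ?_)
    rw [lintegral_const_mul _ (hmeas t)]
    exact mul_le_of_le_one_right' (setLIntegral_moll_le_one hρpos hρi hρint hr₀ t _)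
  have hx : ∀ t ∈ Set.Ioo (0:ℝ) T, ‖∫ x : ℝ, ∫ s in Set.Ioo (0:ℝ) T, ∫ y : ℝ,
        (∫ z in (uG t ⌈x / Δx - 1/2⌉)..(uG t (⌈x / Δx - 1/2⌉ + 1)),
          Real.sign (z - uE y s) * deriv F₂ z)
        * ((testphi ρ r r₀ α ν τ (x + Δx) t y s - testphi ρ r r₀ α ν τ x t y s) / Δx)‖ₑ
      ≤ ENNReal.ofReal Δx * (L₂ * ENNReal.ofReal V * B) := by
    intro t ht
    refine (enorm_integral_le_lintegral_enorm _).trans ((lintegral_mono (hs t)).trans ?_)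
    refine (lintegral_comp_cell_le (fun j => L₂ * ‖uG t (j + 1) - uG t j‖ₑ * B) hΔ).trans ?_
    rw [ENNReal.tsum_mul_right, ENNReal.tsum_mul_left]
    gcongr
    exact hBV t (Set.Ioo_subset_Icc_self ht)
  rw [← Real.norm_eq_abs, ← ENNReal.ofReal_le_ofReal_iff (by positivity), ofReal_norm]
  refine (enorm_integral_le_lintegral_enorm _).trans
    ((setLIntegral_mono' measurableSet_Ioo hx).trans ?_)
  rw [setLIntegral_const, Real.volume_Ioo, sub_zero]
  calc ENNReal.ofReal Δx * (L₂ * ENNReal.ofReal V * B) * ENNReal.ofReal T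
      ≤ ENNReal.ofReal Δx * (L₂ * ENNReal.ofReal |V| * B) * ENNReal.ofReal T := by
        gcongr
        exact le_abs_self V
    _ = ENNReal.ofReal (Δx * (L₂ * |V| * (K / r ^ 2 * (2 * r + Δx))) * T) := by
        rw [hB, ← ENNReal.ofReal_coe_nnreal (p := L₂), ← ENNReal.ofReal_mul (by positivity),
          ← ENNReal.ofReal_mul (by positivity), ← ENNReal.ofReal_mul (by positivity),
          ← ENNReal.ofReal_mul (by positivity), ← ENNReal.ofReal_mul (by positivity)]
    _ ≤ ENNReal.ofReal ((T * L₂ * |V| * K * 2 + 1) * (Δx / r) * (1 + Δx / r)) := by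
        apply ENNReal.ofReal_le_ofReal
        have h1 : Δx * (L₂ * |V| * (K / r ^ 2 * (2 * r + Δx))) * T
            = (T * L₂ * |V| * K) * (Δx / r) * (2 + Δx / r) := by
          field_simp
        have h2 : 0 ≤ (T * L₂ * |V| * K) * (Δx / r) * (Δx / r) := by positivity
        have h3 : 0 ≤ (Δx / r) * (1 + Δx / r) := by positivity
        rw [h1]
        linarith
end
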